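/- arXiv:2204.08902 — 2 statements merged into one kernel-verified Lean document; each statement's English description precedes it below -/
import Mathlib

section
/- Let n ≥ 1 be a natural number, A > 0 and ℓ > 0 real numbers, and let η : ℕ → ℝ (with indices j ≥ 1) be a nondecreasing sequence satisfying the Berezin–Li–Yau inequality with parameters n and A. Then for every real number λ > 0, the number of pairs of positive integers (j, l) with η(j) + π²·l²/ℓ² ≤ λ is at most ω_{n+1} · ℓ · A · (λ / (4π² · α_{n+1}))^{(n+1)/2}. -/
/-- The volume of the unit ball in `ℝ^m`. -/
noncomputable def unitBallVol (m : ℕ) : ℝ :=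
  Real.pi ^ ((m : ℝ) / 2) / Real.Gamma ((m : ℝ) / 2 + 1)

/-- The constant `α_m` from the paper's cylinder theorem. -/
noncomputable def alphaConst (m : ℕ) : ℝ :=
  ((m : ℝ) / ((m : ℝ) + 1) ^ (1 - 1 / (m : ℝ))) * (Real.pi / 4) ^ (1 / (m : ℝ)) *
    (Real.Gamma (((m : ℝ) + 1) / 2) / Real.Gamma (((m : ℝ) + 2) / 2)) ^ (2 / (m : ℝ))

/-- `η` satisfies the Berezin–Li–Yau inequality with parameters `n` and `A`. -/
def BerezinLiYau (n : ℕ) (A : ℝ) (η : ℕ → ℝ) : Prop :=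
  ∀ k : ℕ, 1 ≤ k →
    (n / (n + 2) : ℝ) * (4 * Real.pi ^ 2) * (k : ℝ) ^ (1 + 2 / (n : ℝ))
        / (unitBallVol n * A) ^ ((2 : ℝ) / n)
      ≤ ∑ j ∈ Finset.Icc 1 k, η j

/-- The volume of the unit ball is positive. -/
lemma unitBallVol_pos (m : ℕ) : 0 < unitBallVol m :=
  div_pos (Real.rpow_pos_of_pos Real.pi_pos _) (Real.Gamma_pos_of_pos (by positivity))

/-- The power of `α_{n+1}` that occurs in the counting bound, in closed form. -/
lemma alphaConst_succ_rpow (n : ℕ) :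
    alphaConst (n + 1) ^ (((n : ℝ) + 1) / 2) =
      ((n : ℝ) + 1) ^ (((n : ℝ) + 1) / 2) / ((n : ℝ) + 2) ^ ((n : ℝ) / 2) * (√Real.pi / 2) *
        (Real.Gamma ((n : ℝ) / 2 + 1) / Real.Gamma (((n : ℝ) + 1) / 2 + 1)) := by
  have hπ := Real.pi_pos
  unfold alphaConst
  push_cast
  rw [show ((n : ℝ) + 1 + 1) / 2 = (n : ℝ) / 2 + 1 by ring,
    show ((n : ℝ) + 1 + 2) / 2 = ((n : ℝ) + 1) / 2 + 1 by ring,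
    show (n : ℝ) + 1 + 1 = n + 2 by ring,
    Real.mul_rpow (by positivity) (by positivity), Real.mul_rpow (by positivity) (by positivity),
    Real.div_rpow (by positivity) (by positivity), ← Real.rpow_mul (by positivity),
    ← Real.rpow_mul (by positivity), ← Real.rpow_mul (by positivity),
    show (1 - 1 / ((n : ℝ) + 1)) * (((n : ℝ) + 1) / 2) = n / 2 by field_simp; ring,
    show 1 / ((n : ℝ) + 1) * (((n : ℝ) + 1) / 2) = 1 / 2 by field_simp,
    show 2 / ((n : ℝ) + 1) * (((n : ℝ) + 1) / 2) = 1 by field_simp, Real.rpow_one,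
    ← Real.sqrt_eq_rpow, Real.sqrt_div hπ.le, show (4 : ℝ) = 2 ^ 2 by norm_num,
    Real.sqrt_sq zero_le_two]

/-- The bound of the cylinder theorem, rewritten in terms of the unit ball of the base. -/
lemma unitBallVol_succ_mul_rpow (n : ℕ) {lam : ℝ} (hlam : 0 < lam) :
    unitBallVol (n + 1) * (lam / (4 * Real.pi ^ 2 * alphaConst (n + 1))) ^ (((n : ℝ) + 1) / 2) =
      2 * unitBallVol n * (lam ^ (((n : ℝ) + 1) / 2) / (2 * Real.pi) ^ (n + 1)) *
        (((n : ℝ) + 2) ^ ((n : ℝ) / 2) / ((n : ℝ) + 1) ^ (((n : ℝ) + 1) / 2)) := by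
  have hπ := Real.pi_pos
  have hΓ₁ : 0 < Real.Gamma ((n : ℝ) / 2 + 1) := Real.Gamma_pos_of_pos (by positivity)
  have hΓ₂ : 0 < Real.Gamma (((n : ℝ) + 1) / 2 + 1) := Real.Gamma_pos_of_pos (by positivity)
  have hα : 0 ≤ alphaConst (n + 1) := by
    unfold alphaConst
    have h₁ : 0 ≤ Real.Gamma ((((n + 1 : ℕ) : ℝ) + 1) / 2) :=
      Real.Gamma_nonneg_of_nonneg (by positivity)
    have h₂ : 0 ≤ Real.Gamma ((((n + 1 : ℕ) : ℝ) + 2) / 2) :=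
      Real.Gamma_nonneg_of_nonneg (by positivity)
    positivity
  have h2π : (4 * Real.pi ^ 2) ^ (((n : ℝ) + 1) / 2) = (2 * Real.pi) ^ (n + 1) := by
    rw [show 4 * Real.pi ^ 2 = (2 * Real.pi) ^ (2 : ℝ) by rw [Real.rpow_two]; ring,
      ← Real.rpow_mul (by positivity), ← Real.rpow_natCast]
    congr 1
    push_cast
    ring
  rw [Real.div_rpow hlam.le (by positivity), Real.mul_rpow (by positivity) hα, h2π,
    alphaConst_succ_rpow]
  unfold unitBallVol
  push_cast
  rw [show Real.pi ^ (((n : ℝ) + 1) / 2) = Real.pi ^ ((n : ℝ) / 2) * √Real.pi by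
    rw [Real.sqrt_eq_rpow, ← Real.rpow_add hπ]; ring_nf]
  have h₁ : 0 < ((n : ℝ) + 1) ^ (((n : ℝ) + 1) / 2) := by positivity
  have h₂ : 0 < ((n : ℝ) + 2) ^ ((n : ℝ) / 2) := by positivity
  have h₃ : 0 < √Real.pi := by positivity
  field_simp

/-- Young's inequality in the form of the Legendre transform of `k ↦ C k^{1 + 2/n}`. -/
lemma mul_sub_rpow_le {n : ℕ} (hn : 1 ≤ n) {C k z : ℝ} (hC : 0 < C) (hk : 0 ≤ k) (hz : 0 ≤ z) :
    k * z - n / (n + 2) * (C * k ^ (1 + 2 / (n : ℝ))) ≤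
      2 / (n + 2) * (z ^ (1 + (n : ℝ) / 2) / C ^ ((n : ℝ) / 2)) := by
  have hn₀ : (0 : ℝ) < n := by exact_mod_cast hn
  set r : ℝ := n / (n + 2) with hr
  have hpq : (1 + 2 / (n : ℝ)).HolderConjugate (1 + (n : ℝ) / 2) := by
    rw [Real.holderConjugate_iff]
    refine ⟨lt_add_of_pos_right 1 (by positivity), ?_⟩
    field_simp
    ring
  have h := Real.young_inequality_of_nonneg (a := k * C ^ r) (b := z / C ^ r)
    (by positivity) (by positivity) hpq
  rw [Real.mul_rpow hk (by positivity), Real.div_rpow hz (by positivity), ← Real.rpow_mul hC.le,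
    ← Real.rpow_mul hC.le, show r * (1 + 2 / (n : ℝ)) = 1 by rw [hr]; field_simp,
    show r * (1 + (n : ℝ) / 2) = n / 2 by rw [hr]; field_simp; ring, Real.rpow_one] at h
  have hCr : 0 < C ^ r := by positivity
  have h₁ : k * C ^ r * (z / C ^ r) = k * z := by field_simp
  have h₂ : ∀ x : ℝ, x / (1 + 2 / (n : ℝ)) = n / (n + 2) * x := fun x => by field_simp
  have h₃ : ∀ x : ℝ, x / (1 + (n : ℝ) / 2) = 2 / (n + 2) * x := fun x => by field_simp; ring
  rw [h₁, h₂, h₃] at h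
  linarith [mul_comm C (k ^ (1 + 2 / (n : ℝ)))]

/-- The Berezin–Li–Yau inequality bounds the first Riesz means. -/
lemma BerezinLiYau.sum_sub_le {n : ℕ} (hn : 1 ≤ n) {A : ℝ} (hA : 0 < A) {η : ℕ → ℝ}
    (hBLY : BerezinLiYau n A η) (k : ℕ) {z : ℝ} (hz : 0 ≤ z) :
    ∑ j ∈ Finset.Icc 1 k, (z - η j) ≤
      2 / (n + 2) * (unitBallVol n * A / (2 * Real.pi) ^ n) * z ^ (1 + (n : ℝ) / 2) := by
  have hπ := Real.pi_pos
  have hn₀ : (0 : ℝ) < n := by exact_mod_cast hn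
  have hV : 0 < unitBallVol n * A := mul_pos (unitBallVol_pos n) hA
  rcases Nat.eq_zero_or_pos k with rfl | hk
  · simp only [Finset.Icc_eq_empty_of_lt zero_lt_one, Finset.sum_empty]
    positivity
  set C : ℝ := 4 * Real.pi ^ 2 / (unitBallVol n * A) ^ ((2 : ℝ) / n) with hC
  have hC₀ : 0 < C := by positivity
  have hCn : C ^ ((n : ℝ) / 2) = (2 * Real.pi) ^ n / (unitBallVol n * A) := by
    rw [hC, Real.div_rpow (by positivity) (by positivity), ← Real.rpow_mul hV.le,
      show (2 : ℝ) / n * (n / 2) = 1 by field_simp, Real.rpow_one,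
      show 4 * Real.pi ^ 2 = (2 * Real.pi) ^ (2 : ℝ) by rw [Real.rpow_two]; ring,
      ← Real.rpow_mul (by positivity), show 2 * ((n : ℝ) / 2) = n by ring, Real.rpow_natCast]
  have h := mul_sub_rpow_le hn hC₀ k.cast_nonneg hz
  have hsum := hBLY k hk
  have hsum' : (n / (n + 2) : ℝ) * (4 * Real.pi ^ 2) * (k : ℝ) ^ (1 + 2 / (n : ℝ))
      / (unitBallVol n * A) ^ ((2 : ℝ) / n) =
        n / (n + 2) * (C * (k : ℝ) ^ (1 + 2 / (n : ℝ))) := by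
    rw [hC]
    ring
  rw [hsum'] at hsum
  rw [hCn] at h
  rw [Finset.sum_sub_distrib, Finset.sum_const, Nat.card_Icc, Nat.add_sub_cancel, nsmul_eq_mul]
  calc _ ≤ _ := (sub_le_sub_left hsum _).trans h
    _ = _ := by field_simp

/-- A sequence satisfying the Berezin–Li–Yau inequality is unbounded above. -/
lemma BerezinLiYau.exists_lt {n : ℕ} (hn : 1 ≤ n) {A : ℝ} (hA : 0 < A) {η : ℕ → ℝ}
    (hBLY : BerezinLiYau n A η) {z : ℝ} (hz : 0 ≤ z) : ∃ j, 1 ≤ j ∧ z < η j := by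
  by_contra! h
  set B := 2 / ((n : ℝ) + 2) * (unitBallVol n * A / (2 * Real.pi) ^ n) *
    (z + 1) ^ (1 + (n : ℝ) / 2)
  obtain ⟨k, hk⟩ := exists_nat_gt B
  have h₁ := hBLY.sum_sub_le hn hA k (z := z + 1) (by linarith)
  have h₂ : (k : ℝ) ≤ ∑ j ∈ Finset.Icc 1 k, (z + 1 - η j) := by
    calc (k : ℝ) = ∑ j ∈ Finset.Icc 1 k, (1 : ℝ) := by simp
      _ ≤ _ := Finset.sum_le_sum fun j hj => by
        linarith [h j (Finset.mem_Icc.1 hj).1]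
  linarith

/-- The optimal linear majorant of the square root. -/
lemma sqrt_le_add_div {u d : ℝ} (hu : 0 ≤ u) (hd : 0 < d) : √u ≤ (u + d) / (2 * √d) := by
  rw [le_div_iff₀ (by positivity)]
  nlinarith [sq_nonneg (√u - √d), Real.sq_sqrt hu, Real.sq_sqrt hd.le]

/-- Counting-function form of the paper's main theorem for cylinders `Ω × [0, ℓ]`:
the number of pairs of positive integers `(j, l)` with `η j + π² l²/ℓ² ≤ λ` is at most
`ω_{n+1} ℓ A (λ / (4π² α_{n+1}))^{(n+1)/2}`. -/
theorem cylinder_counting_bound (n : ℕ) (hn : 1 ≤ n) (A ℓ : ℝ) (hA : 0 < A) (hℓ : 0 < ℓ)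
    (η : ℕ → ℝ) (hmono : Monotone η) (hBLY : BerezinLiYau n A η)
    (lam : ℝ) (hlam : 0 < lam) :
    {q : ℕ × ℕ | 1 ≤ q.1 ∧ 1 ≤ q.2 ∧
        η q.1 + Real.pi ^ 2 * (q.2 : ℝ) ^ 2 / ℓ ^ 2 ≤ lam}.Finite ∧
      (Nat.card {q : ℕ × ℕ | 1 ≤ q.1 ∧ 1 ≤ q.2 ∧
          η q.1 + Real.pi ^ 2 * (q.2 : ℝ) ^ 2 / ℓ ^ 2 ≤ lam} : ℝ)
        ≤ unitBallVol (n + 1) * ℓ * A *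
            (lam / (4 * Real.pi ^ 2 * alphaConst (n + 1))) ^ (((n : ℝ) + 1) / 2) := by
  have hπ := Real.pi_pos
  obtain ⟨k, hk⟩ : ∃ k, ∀ j, 1 ≤ j → (η j ≤ lam ↔ j ≤ k) := by
    classical
    have hex := hBLY.exists_lt hn hA hlam.le
    obtain ⟨h1, hlt⟩ := Nat.find_spec hex
    refine ⟨Nat.find hex - 1, fun j hj => ⟨fun hle => ?_, fun hle => ?_⟩⟩
    · by_contra! hcon
      exact (hlt.trans_le (hmono (by omega : Nat.find hex ≤ j))).not_ge hle
    · by_contra! hcon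
      have := Nat.find_min' hex ⟨hj, hcon⟩
      omega
  set F : ℕ → ℕ := fun j => ⌊ℓ / Real.pi * √(lam - η j)⌋₊
  set T : Finset (ℕ × ℕ) :=
    (Finset.Icc 1 k).biUnion fun j => (Finset.Icc 1 (F j)).image (Prod.mk j) with hT
  have hsub : {q : ℕ × ℕ | 1 ≤ q.1 ∧ 1 ≤ q.2 ∧
      η q.1 + Real.pi ^ 2 * (q.2 : ℝ) ^ 2 / ℓ ^ 2 ≤ lam} ⊆ T := by
    rintro ⟨j, l⟩ ⟨hj, hl, hle⟩
    simp only at hj hl hle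
    have hnonneg : 0 ≤ Real.pi ^ 2 * (l : ℝ) ^ 2 / ℓ ^ 2 := by positivity
    have hlF : l ≤ F j := by
      refine Nat.le_floor ?_
      have : Real.pi * l / ℓ ≤ √(lam - η j) := by
        apply Real.le_sqrt_of_sq_le
        rw [div_pow, mul_pow]
        linarith
      calc (l : ℝ) = ℓ / Real.pi * (Real.pi * l / ℓ) := by field_simp
        _ ≤ _ := by gcongr
    simpa [hT] using ⟨⟨hl, hlF⟩, hj, (hk j hj).1 (by linarith)⟩
  refine ⟨T.finite_toSet.subset hsub, ?_⟩
  set d : ℝ := lam / (n + 1) with hd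
  have hd₀ : 0 < d := by positivity
  have hterm : ∀ j ∈ Finset.Icc 1 k,
      (F j : ℝ) ≤ ℓ / Real.pi / (2 * √d) * (lam + d - η j) := fun j hj => by
    obtain ⟨hj1, hjk⟩ := Finset.mem_Icc.1 hj
    have hu : 0 ≤ lam - η j := sub_nonneg.2 ((hk j hj1).2 hjk)
    calc (F j : ℝ) ≤ ℓ / Real.pi * √(lam - η j) := Nat.floor_le (by positivity)
      _ ≤ ℓ / Real.pi * ((lam - η j + d) / (2 * √d)) := by
        gcongr
        exact sqrt_le_add_div hu hd₀
      _ = _ := by ring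
  have hcard : T.card ≤ ∑ j ∈ Finset.Icc 1 k, F j :=
    Finset.card_biUnion_le.trans <| Finset.sum_le_sum fun j _ =>
      Finset.card_image_le.trans (by simp)
  have hcount : Nat.card {q : ℕ × ℕ | 1 ≤ q.1 ∧ 1 ≤ q.2 ∧
      η q.1 + Real.pi ^ 2 * (q.2 : ℝ) ^ 2 / ℓ ^ 2 ≤ lam} ≤ T.card := by
    simpa using Nat.card_mono T.finite_toSet hsub
  calc (Nat.card {q : ℕ × ℕ | 1 ≤ q.1 ∧ 1 ≤ q.2 ∧
          η q.1 + Real.pi ^ 2 * (q.2 : ℝ) ^ 2 / ℓ ^ 2 ≤ lam} : ℝ)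
      ≤ ∑ j ∈ Finset.Icc 1 k, (F j : ℝ) := by exact_mod_cast hcount.trans hcard
    _ ≤ ∑ j ∈ Finset.Icc 1 k, ℓ / Real.pi / (2 * √d) * (lam + d - η j) :=
      Finset.sum_le_sum hterm
    _ = ℓ / Real.pi / (2 * √d) * ∑ j ∈ Finset.Icc 1 k, (lam + d - η j) := by
      rw [Finset.mul_sum]
    _ ≤ ℓ / Real.pi / (2 * √d) * (2 / (n + 2) * (unitBallVol n * A / (2 * Real.pi) ^ n) *
          (lam + d) ^ (1 + (n : ℝ) / 2)) := by
      gcongr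
      exact hBLY.sum_sub_le hn hA k (by positivity)
    _ = ℓ * A * (unitBallVol (n + 1) *
          (lam / (4 * Real.pi ^ 2 * alphaConst (n + 1))) ^ (((n : ℝ) + 1) / 2)) := by
      have hsplit : ∀ x : ℝ, 0 < x → x ^ (((n : ℝ) + 1) / 2) = x ^ ((n : ℝ) / 2) * √x :=
        fun x hx => by rw [Real.sqrt_eq_rpow, ← Real.rpow_add hx]; ring_nf
      have hτ : lam + d = lam * (n + 2) / (n + 1) := by
        rw [hd]
        field_simp
        ring
      rw [unitBallVol_succ_mul_rpow n hlam, hτ, hsplit _ hlam, hsplit _ (by positivity),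
        Real.rpow_add (by positivity), Real.rpow_one, Real.div_rpow (by positivity) (by positivity),
        Real.mul_rpow hlam.le (by positivity), hd, Real.sqrt_div hlam.le]
      have h₁ : 0 < ((n : ℝ) + 1) ^ ((n : ℝ) / 2) := by positivity
      have h₂ : √lam ^ 2 = lam := Real.sq_sqrt hlam.le
      have h₃ : √((n : ℝ) + 1) ^ 2 = n + 1 := Real.sq_sqrt (by positivity)
      have h₄ : 0 < √lam := by positivity
      field_simp
      rw [h₂, h₃]
      ring
    _ = _ := by ring
end

section
/- For every natural number n ≥ 2, one has α_{n+1} < ((n+1)/(n+2)) · (π/2)^{1/(n+1)} · ((n+3)/(n+2))^{1/(n+1)} < 1. -/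
open Real in
/-- Wendel's inequality at step `1 / 2`, by log-convexity of the Gamma function. -/
theorem sq_mul_Gamma_sq_le {x : ℝ} (hx : 0 < x) :
    x ^ 2 * Gamma x ^ 2 ≤ (x + 1 / 2) * Gamma (x + 1 / 2) ^ 2 := by
  have hx' : 0 < x + 1 / 2 := by linarith
  have hG := Gamma_pos_of_pos hx'
  have h := Gamma_mul_add_mul_le_rpow_Gamma_mul_rpow_Gamma hx' (by linarith : 0 < x + 1 / 2 + 1)
    (by norm_num : (0 : ℝ) < 1 / 2) (by norm_num : (0 : ℝ) < 1 / 2) (by norm_num)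
  rw [show 1 / 2 * (x + 1 / 2) + 1 / 2 * (x + 1 / 2 + 1) = x + 1 by ring, Gamma_add_one hx.ne',
    Gamma_add_one hx'.ne', ← sqrt_eq_rpow, ← sqrt_eq_rpow, ← sqrt_mul hG.le] at h
  have h0 : 0 ≤ x * Gamma x := (mul_pos hx (Gamma_pos_of_pos hx)).le
  have h1 := (le_sqrt h0 (by positivity)).1 h
  linarith

open Real in
/-- The inequality `sq_mul_Gamma_sq_le` is strict: pass from `x` to `x + 1`. -/
theorem sq_mul_Gamma_sq_lt {x : ℝ} (hx : 0 < x) :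
    x ^ 2 * Gamma x ^ 2 < (x + 1 / 2) * Gamma (x + 1 / 2) ^ 2 := by
  have hx' : 0 < x + 1 / 2 := by linarith
  have hA := Gamma_pos_of_pos hx
  have h := sq_mul_Gamma_sq_le (by linarith : 0 < x + 1)
  rw [show x + 1 + 1 / 2 = x + 1 / 2 + 1 by ring, Gamma_add_one hx.ne',
    Gamma_add_one hx'.ne'] at h
  have hlt : (x + 1 / 2) * (x + 1 / 2 + 1) * (x ^ 2 * Gamma x ^ 2)
      < (x + 1) ^ 2 * (x ^ 2 * Gamma x ^ 2) :=
    mul_lt_mul_of_pos_right (by nlinarith) (by positivity)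
  refine lt_of_mul_lt_mul_left (a := (x + 1 / 2) * (x + 1 / 2 + 1)) ?_ (by positivity)
  linarith

open Real in
theorem alphaConst_eq {m : ℕ} (hm : m ≠ 0) :
    alphaConst m = (m : ℝ) / (m + 1) * ((m + 1) * (π / 4) *
      (Gamma (((m : ℝ) + 1) / 2) / Gamma (((m : ℝ) + 2) / 2)) ^ 2) ^ (1 / (m : ℝ)) := by
  have hA : 0 < Gamma (((m : ℝ) + 1) / 2) := Gamma_pos_of_pos (by positivity)
  have hB : 0 < Gamma (((m : ℝ) + 2) / 2) := Gamma_pos_of_pos (by positivity)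
  have hm1 : (0 : ℝ) < m + 1 := by positivity
  rw [alphaConst, mul_rpow (by positivity) (by positivity), mul_rpow hm1.le (by positivity),
    rpow_sub hm1, rpow_one, ← rpow_natCast_mul (by positivity)]
  have hp := rpow_pos_of_pos hm1 (1 / (m : ℝ))
  rw [show ((2 : ℕ) : ℝ) * (1 / (m : ℝ)) = 2 / m by push_cast; ring]
  field_simp

open Real in
theorem alphaConst_lt {m : ℕ} (hm : m ≠ 0) :
    alphaConst m < (m : ℝ) / (m + 1) * (π / 2 * ((m + 2) / (m + 1))) ^ (1 / (m : ℝ)) := by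
  have hm0 : (0 : ℝ) < m := by positivity
  have hB : 0 < Gamma (((m : ℝ) + 2) / 2) := Gamma_pos_of_pos (by positivity)
  have h := sq_mul_Gamma_sq_lt (by positivity : 0 < ((m : ℝ) + 1) / 2)
  rw [show ((m : ℝ) + 1) / 2 + 1 / 2 = (m + 2) / 2 by ring] at h
  rw [alphaConst_eq hm]
  refine mul_lt_mul_of_pos_left (rpow_lt_rpow (by positivity) ?_ (by positivity)) (by positivity)
  have hR : (Gamma (((m : ℝ) + 1) / 2) / Gamma (((m : ℝ) + 2) / 2)) ^ 2
      < 2 * (m + 2) / (m + 1) ^ 2 := by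
    rw [div_pow, div_lt_div_iff₀ (by positivity) (by positivity)]
    linarith
  calc _ < ((m : ℝ) + 1) * (π / 4) * (2 * (m + 2) / (m + 1) ^ 2) :=
        mul_lt_mul_of_pos_left hR (by positivity)
    _ = _ := by field_simp; ring

open Real in
theorem div_mul_rpow_pi_lt_one {m : ℕ} (hm : 3 ≤ m) :
    (m : ℝ) / (m + 1) * (π / 2 * ((m + 2) / (m + 1))) ^ (1 / (m : ℝ)) < 1 := by
  have hm3 : (3 : ℝ) ≤ m := by exact_mod_cast hm
  have hm0 : (0 : ℝ) < m := by linarith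
  have hbern : 2 ≤ (((m : ℝ) + 1) / m) ^ m := by
    have h := one_add_mul_le_pow (a := 1 / (m : ℝ)) (by linarith [one_div_pos.2 hm0]) m
    rw [mul_one_div_cancel hm0.ne', show 1 + 1 / (m : ℝ) = (m + 1) / m by field_simp] at h
    linarith
  have hpi : π / 2 * (((m : ℝ) + 2) / (m + 1)) < 2 := by
    rw [← mul_div_assoc, div_lt_iff₀ (by positivity)]
    nlinarith [pi_lt_d2]
  have h : (π / 2 * (((m : ℝ) + 2) / (m + 1))) ^ (1 / (m : ℝ)) < (m + 1) / m := by
    calc _ < ((((m : ℝ) + 1) / m) ^ m) ^ (1 / (m : ℝ)) :=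
          rpow_lt_rpow (by positivity) (hpi.trans_le hbern) (by positivity)
      _ = _ := by rw [one_div, pow_rpow_inv_natCast (by positivity) (by lia)]
  calc _ < (m : ℝ) / (m + 1) * ((m + 1) / m) := mul_lt_mul_of_pos_left h (by positivity)
    _ = 1 := by field_simp

/-- Upper-bound part of the chain of inequalities in the cylinder theorem:
`α_{n+1} < ((n+1)/(n+2)) (π/2)^{1/(n+1)} ((n+3)/(n+2))^{1/(n+1)} < 1`. -/
theorem alpha_upper_bounds (n : ℕ) (hn : 2 ≤ n) :
    alphaConst (n + 1)
        < (((n : ℝ) + 1) / ((n : ℝ) + 2)) * (Real.pi / 2) ^ ((1 : ℝ) / ((n : ℝ) + 1))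
            * (((n : ℝ) + 3) / ((n : ℝ) + 2)) ^ ((1 : ℝ) / ((n : ℝ) + 1)) ∧
      (((n : ℝ) + 1) / ((n : ℝ) + 2)) * (Real.pi / 2) ^ ((1 : ℝ) / ((n : ℝ) + 1))
          * (((n : ℝ) + 3) / ((n : ℝ) + 2)) ^ ((1 : ℝ) / ((n : ℝ) + 1)) < 1 := by
  have h1 := alphaConst_lt (Nat.succ_ne_zero n)
  have h2 := div_mul_rpow_pi_lt_one (by lia : 3 ≤ n + 1)
  simp only [Nat.succ_eq_add_one] at h1
  push_cast at h1 h2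
  rw [show (n : ℝ) + 1 + 1 = n + 2 by ring, show (n : ℝ) + 1 + 2 = n + 3 by ring] at h1 h2
  rw [mul_assoc, ← Real.mul_rpow (by positivity) (by positivity)]
  exact ⟨h1, h2⟩
end
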